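/- (Proposition 2, first statement, deterministic sample-path version) If (W^c, W^r, u) optimally solves problem (7), then (W^c + Σ_i e_i, v) optimally solves problem (10), where e_i = W_i^r − W_i^L (so e_i ≥ 0 by feasibility) and v is the scheduler defined by v_i(t) = 1 if (u_i(t) = 1 and W_i(t) > W_i^L + e_i) or W_i^L ≤ W_i(t) ≤ W_i^L + e_i, and v_i(t) = 0 otherwise. -/

import Mathlib

open Filter Finset

noncomputable section

/-- `{0,1}`-valued real indicator of a proposition. -/
def ind (P : Prop) [Decidable P] : ℝ := if P then 1 else 0

/-- Positive part `[x]^+ = max(x,0)`. -/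
def pos (x : ℝ) : ℝ := max x 0

/-- A scheduler takes values in `{0,1}`. -/
def IsScheduler {N : ℕ} (u : ℕ → Fin N → ℝ) : Prop :=
  ∀ t i, u t i = 0 ∨ u t i = 1

/-- Feasibility of the triple `(Wc, Wr, u)` for problem (7). -/
def Feasible7 {N : ℕ} (W : ℕ → Fin N → ℝ) (PH : Fin N → ℝ) (F : Fin N → ℝ → ℝ)
    (WL : Fin N → ℝ) (Wc : ℝ) (Wr : Fin N → ℝ) (u : ℕ → Fin N → ℝ) : Prop :=
  (∀ i, PH i - F i (Wr i) ≤
      Filter.liminf (fun T : ℕ =>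
        (1 / (T : ℝ)) * ∑ t ∈ Finset.Icc 1 T, u t i * ind (Wr i < W t i)) Filter.atTop) ∧
  (∀ i, WL i ≤ Wr i) ∧
  (∀ t, ∑ i, u t i * pos (W t i - Wr i) ≤ Wc + ∑ i, pos (Wr i - W t i)) ∧
  IsScheduler u

/-- Objective value of problem (7). -/
def objective7 {N : ℕ} (Wc : ℝ) (Wr : Fin N → ℝ) : ℝ := Wc + ∑ i, Wr i

/-- Optimality of the triple `(Wc, Wr, u)` for problem (7). -/
def Optimal7 {N : ℕ} (W : ℕ → Fin N → ℝ) (PH : Fin N → ℝ) (F : Fin N → ℝ → ℝ)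
    (WL : Fin N → ℝ) (Wc : ℝ) (Wr : Fin N → ℝ) (u : ℕ → Fin N → ℝ) : Prop :=
  Feasible7 W PH F WL Wc Wr u ∧
  ∀ (Wc' : ℝ) (Wr' : Fin N → ℝ) (u' : ℕ → Fin N → ℝ),
    Feasible7 W PH F WL Wc' Wr' u' → objective7 Wc Wr ≤ objective7 Wc' Wr'

/-- Feasibility of the pair `(Wc, u)` for problem (10), where `P^M_i = F_i(W_i^L)`. -/
def Feasible10 {N : ℕ} (W : ℕ → Fin N → ℝ) (PH : Fin N → ℝ) (F : Fin N → ℝ → ℝ)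
    (WL : Fin N → ℝ) (Wc : ℝ) (u : ℕ → Fin N → ℝ) : Prop :=
  (∀ i, PH i - F i (WL i) ≤
      Filter.liminf (fun T : ℕ =>
        (1 / (T : ℝ)) * ∑ t ∈ Finset.Icc 1 T, u t i * ind (WL i < W t i)) Filter.atTop) ∧
  (∀ t, ∑ i, u t i * pos (W t i - WL i) ≤ Wc + ∑ i, pos (WL i - W t i)) ∧
  IsScheduler u

/-- Optimality of the pair `(Wc, u)` for problem (10); the objective is `Wc`. -/
def Optimal10 {N : ℕ} (W : ℕ → Fin N → ℝ) (PH : Fin N → ℝ) (F : Fin N → ℝ → ℝ)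
    (WL : Fin N → ℝ) (Wc : ℝ) (u : ℕ → Fin N → ℝ) : Prop :=
  Feasible10 W PH F WL Wc u ∧
  ∀ (Wc' : ℝ) (u' : ℕ → Fin N → ℝ), Feasible10 W PH F WL Wc' u' → Wc ≤ Wc'

/-- Adding a convergent sequence to a sequence with values in `[0, 1]` shifts the lower limit by at
least the limit. -/
theorem liminf_add_le_liminf_of_tendsto {a b : ℕ → ℝ} {l : ℝ} (ha₀ : ∀ n, 0 ≤ a n)
    (ha₁ : ∀ n, a n ≤ 1) (hb : Tendsto b atTop (nhds l)) :
    liminf a atTop + l ≤ liminf (fun n => a n + b n) atTop := by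
  rw [← hb.liminf_eq]
  exact le_liminf_add (isBoundedUnder_of ⟨0, ha₀⟩) (isBoundedUnder_of ⟨1, ha₁⟩)
    hb.isBoundedUnder_ge hb.isBoundedUnder_le.isCoboundedUnder_ge

/-- Running averages of a sequence with values in `[0, 1]` lie in `[0, 1]`. -/
theorem average_mem_Icc {f : ℕ → ℝ} (hf : ∀ t, f t ∈ Set.Icc (0 : ℝ) 1) (T : ℕ) :
    (1 / (T : ℝ)) * ∑ t ∈ Finset.Icc 1 T, f t ∈ Set.Icc (0 : ℝ) 1 := by
  refine ⟨mul_nonneg (by positivity) (Finset.sum_nonneg fun t _ => (hf t).1), ?_⟩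
  rw [one_div_mul_eq_div]
  refine div_le_one_of_le₀ ?_ (by positivity)
  simpa using Finset.sum_le_card_nsmul (Finset.Icc 1 T) f 1 fun t _ => (hf t).2

/-- The scheduler for threshold `l` that serves every demand in `[l, r]`, and follows the binary
decision `u` above `r`, serves demand above `l` as often as `u` does above `r`, plus the demands
in `(l, r]`. -/
theorem ind_extend_mul_ind {u w l r : ℝ} (hu : u = 0 ∨ u = 1) (hlr : l ≤ r) :
    ind ((u = 1 ∧ l + (r - l) < w) ∨ (l ≤ w ∧ w ≤ l + (r - l))) * ind (l < w) =
      u * ind (r < w) + (ind (w ≤ r) - ind (w ≤ l)) := by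
  rw [add_sub_cancel]
  unfold ind
  rcases hu with rfl | rfl <;> grind

/-- The net excess over `l` of the extended scheduler is at most the net excess over `r` of `u`,
plus `r - l`. -/
theorem ind_extend_mul_pos_le {u w l r : ℝ} (hu : u = 0 ∨ u = 1) (hlr : l ≤ r) :
    ind ((u = 1 ∧ l + (r - l) < w) ∨ (l ≤ w ∧ w ≤ l + (r - l))) * pos (w - l) + pos (r - w) ≤
      u * pos (w - r) + (r - l) + pos (l - w) := by
  rw [add_sub_cancel]
  unfold ind pos
  rcases hu with rfl | rfl <;> split_ifs <;> grind

/-- Proposition 2, first statement (deterministic sample-path version). -/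
theorem proposition2_first {N : ℕ} (W : ℕ → Fin N → ℝ) (PH PL : Fin N → ℝ) (F : Fin N → ℝ → ℝ)
    (hF : ∀ i x, Filter.Tendsto
      (fun T : ℕ => (1 / (T : ℝ)) * ∑ t ∈ Finset.Icc 1 T, ind (W t i ≤ x))
      Filter.atTop (nhds (F i x)))
    (WL : Fin N → ℝ) (hWL : ∀ i, PL i ≤ F i (WL i))
    (Wc : ℝ) (Wr : Fin N → ℝ) (u : ℕ → Fin N → ℝ)
    (hopt : Optimal7 W PH F WL Wc Wr u) :
    Optimal10 W PH F WL (Wc + ∑ i, (Wr i - WL i))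
      (fun t i => ind ((u t i = 1 ∧ WL i + (Wr i - WL i) < W t i) ∨
        (WL i ≤ W t i ∧ W t i ≤ WL i + (Wr i - WL i)))) := by
  obtain ⟨⟨hfreq, hle, hcap, hu⟩, hmin⟩ := hopt
  refine ⟨⟨fun i => ?_, fun t => ?_, fun t i => ?_⟩, fun Wc' u' ⟨hfreq', hcap', hu'⟩ => ?_⟩
  · have hserved : ∀ t, u t i * ind (Wr i < W t i) ∈ Set.Icc (0 : ℝ) 1 := fun t => by
      unfold ind
      rcases hu t i with h | h <;> rw [h] <;> split_ifs <;> norm_num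
    have hlim := liminf_add_le_liminf_of_tendsto (fun T => (average_mem_Icc hserved T).1)
      (fun T => (average_mem_Icc hserved T).2) ((hF i (Wr i)).sub (hF i (WL i)))
    simp only [ind_extend_mul_ind (hu _ i) (hle i), Finset.sum_add_distrib,
      Finset.sum_sub_distrib, mul_add, mul_sub]
    linarith [hfreq i]
  · have hsum := Finset.sum_le_sum fun i (_ : i ∈ Finset.univ) =>
      ind_extend_mul_pos_le (w := W t i) (hu t i) (hle i)
    simp only [Finset.sum_add_distrib] at hsum
    linarith [hcap t]
  · dsimp only [ind]
    split_ifs <;> simp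
  · have hobj := hmin Wc' WL u' ⟨hfreq', fun _ => le_rfl, hcap', hu'⟩
    unfold objective7 at hobj
    rw [Finset.sum_sub_distrib]
    linarith
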